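/- arXiv:2402.11990 — 2 statements merged into one kernel-verified Lean document; each statement's English description precedes it below -/
import Mathlib

section
/- Let T be a positive integer and let Z be a Poisson random variable with rate T (i.e. P(Z = k) = e^{−T} T^k / k! for each nonnegative integer k). Then P(Z ≥ T) ≥ 1/2. -/
open MeasureTheory

/-- Around its mode `T`, the weights `T ^ k / k!` are at least as large at `T + j` as at the
mirrored index `a = T - 1 - j`. -/
theorem pow_div_factorial_le_mirror {T : ℕ} (j : ℕ) : ∀ a : ℕ, a + 1 + j = T →
    (T : ℝ) ^ a / a.factorial ≤ (T : ℝ) ^ (T + j) / (T + j).factorial := by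
  induction j with
  | zero =>
    rintro a rfl
    have ha : ((a : ℝ) + 1) ≠ 0 := by positivity
    have hf : (a.factorial : ℝ) ≠ 0 := by positivity
    apply le_of_eq
    simp only [add_zero, Nat.factorial_succ, pow_succ]
    push_cast
    field_simp
  | succ j ih =>
    intro a h
    have hT : (T : ℝ) = a + 1 + (j + 1) := by exact_mod_cast h.symm
    have hpos : (0 : ℝ) < T := by rw [hT]; positivity
    have hratio : ((a : ℝ) + 1) / T ≤ T / (T + j + 1) := by
      rw [div_le_div_iff₀ hpos (by positivity)]
      rw [hT]
      nlinarith [sq_nonneg ((j : ℝ) + 1)]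
    calc (T : ℝ) ^ a / a.factorial
        = (T : ℝ) ^ (a + 1) / (a + 1).factorial * ((a + 1) / T) := by
          rw [Nat.factorial_succ, pow_succ]
          push_cast
          field_simp
      _ ≤ (T : ℝ) ^ (T + j) / (T + j).factorial * (T / (T + j + 1)) :=
          mul_le_mul (ih (a + 1) (by omega)) hratio (by positivity) (by positivity)
      _ = (T : ℝ) ^ (T + (j + 1)) / (T + (j + 1)).factorial := by
          rw [← add_assoc, Nat.factorial_succ, pow_succ]
          push_cast
          field_simp

theorem two_mul_sum_pow_div_factorial_le_exp (T : ℕ) :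
    2 * ∑ k ∈ Finset.range T, (T : ℝ) ^ k / k.factorial ≤ Real.exp T := by
  have hmirror : ∑ k ∈ Finset.range T, (T : ℝ) ^ k / k.factorial
      ≤ ∑ j ∈ Finset.range T, (T : ℝ) ^ (T + j) / (T + j).factorial := by
    rw [← Finset.sum_range_reflect]
    refine Finset.sum_le_sum fun j hj => pow_div_factorial_le_mirror j _ ?_
    have := Finset.mem_range.mp hj
    omega
  have hexp := Real.sum_le_exp_of_nonneg (Nat.cast_nonneg (α := ℝ) T) (T + T)
  rw [Finset.sum_range_add] at hexp
  linarith

/-- If `Z` is a Poisson random variable whose rate is a positive integer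
`T`, then `P(Z ≥ T) ≥ 1/2`. -/
theorem poisson_ge_rate (T : ℕ) (hT : 1 ≤ T)
    (Ω : Type) [MeasurableSpace Ω] (μ : Measure Ω) [IsProbabilityMeasure μ]
    (Z : Ω → ℕ)
    (hZ : ∀ k : ℕ, μ {ω | Z ω = k}
      = ENNReal.ofReal (Real.exp (-(T : ℝ)) * (T : ℝ) ^ k / k.factorial)) :
    1 / 2 ≤ μ {ω | T ≤ Z ω} := by
  have hsum : ∑ k ∈ Finset.range T, Real.exp (-(T : ℝ)) * (T : ℝ) ^ k / k.factorial ≤ 1 / 2 := by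
    simp_rw [mul_div_assoc]
    rw [← Finset.mul_sum, Real.exp_neg, inv_mul_le_iff₀ (Real.exp_pos _)]
    linarith [two_mul_sum_pow_div_factorial_le_exp T]
  have hlow : μ {ω | Z ω < T} ≤ 1 / 2 := by
    have hset : {ω | Z ω < T} = ⋃ k ∈ Finset.range T, {ω | Z ω = k} := by
      ext ω
      simp
    calc μ {ω | Z ω < T} ≤ ∑ k ∈ Finset.range T, μ {ω | Z ω = k} := by
          rw [hset]
          exact measure_biUnion_finset_le _ _
      _ = ENNReal.ofReal
            (∑ k ∈ Finset.range T, Real.exp (-(T : ℝ)) * (T : ℝ) ^ k / k.factorial) := by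
          rw [ENNReal.ofReal_sum_of_nonneg fun k _ => by positivity]
          exact Finset.sum_congr rfl fun k _ => hZ k
      _ ≤ ENNReal.ofReal (1 / 2) := ENNReal.ofReal_le_ofReal hsum
      _ = 1 / 2 := by
          rw [ENNReal.ofReal_div_of_pos two_pos]
          simp
  have hcover : 1 ≤ μ {ω | Z ω < T} + μ {ω | T ≤ Z ω} := by
    rw [← measure_univ (μ := μ)]
    refine (measure_mono fun ω _ => ?_).trans (measure_union_le _ _)
    exact lt_or_ge (Z ω) T
  have hhalf : (1 / 2 : ENNReal) + 1 / 2 ≤ 1 / 2 + μ {ω | T ≤ Z ω} := by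
    rw [ENNReal.add_halves]
    exact hcover.trans (by gcongr)
  exact (ENNReal.add_le_add_iff_left (by simp)).mp hhalf
end

section
/- Let T be a positive integer and let Z be a Poisson random variable with rate T (i.e. P(Z = k) = e^{−T} T^k / k! for each nonnegative integer k). Then P(Z ≤ T − √T) ≥ e^{−9}. -/
open MeasureTheory

/-- Subadditivity alone bounds the measure of a union of fibres from below, provided the measures
of all fibres add up to one; no measurability of `Z` is needed. -/
lemma sum_measure_fiber_le_measure_preimage {Ω : Type*} [MeasurableSpace Ω] (μ : Measure Ω)
    [IsProbabilityMeasure μ] (Z : Ω → ℕ) (h : ∑' k, μ {ω | Z ω = k} = 1) (F : Finset ℕ) :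
    ∑ k ∈ F, μ {ω | Z ω = k} ≤ μ {ω | Z ω ∈ F} := by
  set R := ∑' k : ↥((F : Set ℕ)ᶜ), μ {ω | Z ω = k}
  have hsplit : ∑ k ∈ F, μ {ω | Z ω = k} + R = 1 := by
    rw [← h]
    exact ENNReal.sum_add_tsum_compl F fun k ↦ μ {ω | Z ω = k}
  have hRtop : R ≠ ⊤ := fun hr ↦ by simp [hr] at hsplit
  have hcompl : μ {ω | Z ω ∉ F} ≤ R := by
    refine le_trans (measure_mono fun ω hω ↦ ?_) (measure_iUnion_le _)
    exact Set.mem_iUnion.2 ⟨⟨Z ω, by simpa using hω⟩, rfl⟩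
  have huniv : (1 : ENNReal) ≤ μ {ω | Z ω ∈ F} + μ {ω | Z ω ∉ F} := by
    rw [← measure_univ (μ := μ)]
    refine le_trans (measure_mono fun ω _ ↦ ?_) (measure_union_le _ _)
    exact em (Z ω ∈ F)
  rw [← ENNReal.add_le_add_iff_right hRtop, hsplit]
  exact huniv.trans (by gcongr)

lemma factorial_le_exp_mul_sqrt_mul_pow {n : ℕ} (hn : 1 ≤ n) :
    (n.factorial : ℝ) ≤ Real.exp 1 * √n * (n / Real.exp 1) ^ n := by
  obtain ⟨m, rfl⟩ : ∃ m, n = m + 1 := ⟨n - 1, by omega⟩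
  have h : Stirling.stirlingSeq (m + 1) ≤ Stirling.stirlingSeq 1 :=
    Stirling.stirlingSeq'_antitone (Nat.zero_le m)
  rw [Stirling.stirlingSeq_one, Stirling.stirlingSeq, div_le_iff₀ (by positivity)] at h
  refine h.trans_eq ?_
  rw [Real.sqrt_mul (by norm_num)]
  field_simp

lemma exp_neg_three_mul_le_one_sub {x : ℝ} (h0 : 0 ≤ x) (h1 : x ≤ 2 / 3) :
    Real.exp (-(3 * x)) ≤ 1 - x := by
  rw [Real.exp_neg, inv_le_comm₀ (Real.exp_pos _) (by linarith)]
  refine le_trans ?_ (Real.add_one_le_exp _)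
  rw [inv_le_iff_one_le_mul₀ (by linarith)]
  nlinarith

lemma pow_mul_exp_le_descFactorial {n : ℕ} (hn : 1 ≤ n) (j : ℕ) (hj : 3 * j ≤ 2 * n + 3) :
    (n : ℝ) ^ j * Real.exp (-(3 * (j * (j - 1)) / (2 * n))) ≤ n.descFactorial j := by
  have hn' : (0 : ℝ) < n := by exact_mod_cast hn
  induction j with
  | zero => simp
  | succ j ih =>
    have hjn : (3 : ℝ) * j ≤ 2 * n := by exact_mod_cast (by omega : 3 * j ≤ 2 * n)
    have hstep := exp_neg_three_mul_le_one_sub (x := j / n) (by positivity)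
      (by rw [div_le_iff₀ hn']; linarith)
    rw [Nat.descFactorial_succ, Nat.cast_mul, Nat.cast_sub (by omega)]
    calc (n : ℝ) ^ (j + 1) * Real.exp (-(3 * ((j + 1 : ℕ) * ((j + 1 : ℕ) - 1)) / (2 * n)))
        = n * Real.exp (-(3 * (j / n))) *
            (n ^ j * Real.exp (-(3 * (j * (j - 1)) / (2 * n)))) := by
          have : -(3 * (((j + 1 : ℕ) : ℝ) * ((j + 1 : ℕ) - 1)) / (2 * n))
              = -(3 * (j / n)) + -(3 * ((j : ℝ) * (j - 1)) / (2 * n)) := by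
            push_cast
            field_simp
            ring
          rw [this, Real.exp_add]
          ring
      _ ≤ n * (1 - j / n) * n.descFactorial j := by
          gcongr
          · exact mul_nonneg hn'.le ((Real.exp_pos _).le.trans hstep)
          · exact ih (by omega)
      _ = (n - j) * n.descFactorial j := by
          field_simp

/-- The Poisson weight of `n - j` at integer rate `n`, bounded below by Stirling's formula. -/
lemma exp_div_sqrt_le_poisson_weight {n j : ℕ} (hn : 1 ≤ n) (hjn : j ≤ n)
    (hj : 3 * j ≤ 2 * n + 3) :
    Real.exp (-1 - 3 * (j * (j - 1)) / (2 * n)) / √n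
      ≤ Real.exp (-(n : ℝ)) * n ^ (n - j) / (n - j).factorial := by
  have hn' : (0 : ℝ) < n := by exact_mod_cast hn
  have hs : 0 < √(n : ℝ) := Real.sqrt_pos.2 hn'
  have hf : ((n - j).factorial : ℝ) * n.descFactorial j = n.factorial := by
    exact_mod_cast Nat.factorial_mul_descFactorial hjn
  have hd := pow_mul_exp_le_descFactorial hn j hj
  have hst := factorial_le_exp_mul_sqrt_mul_pow hn
  have hfac : (0 : ℝ) < (n - j).factorial := by positivity
  rw [div_le_div_iff₀ hs hfac]
  set E := Real.exp (-(3 * ((j : ℝ) * (j - 1)) / (2 * n))) with hE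
  have h1 : (n - j).factorial * ((n : ℝ) ^ j * E)
      ≤ Real.exp 1 * √n * (n / Real.exp 1) ^ n := by
    refine le_trans ?_ hst
    rw [← hf]
    gcongr
  have h2 : Real.exp (-1 - 3 * ((j : ℝ) * (j - 1)) / (2 * n)) = (Real.exp 1)⁻¹ * E := by
    rw [hE, ← Real.exp_neg, ← Real.exp_add]
    ring_nf
  have h3 : Real.exp (-(n : ℝ)) = (Real.exp 1 ^ n)⁻¹ := by
    rw [← Real.exp_nat_mul, Real.exp_neg, mul_one]
  have h4 : (n : ℝ) ^ n = n ^ (n - j) * n ^ j := by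
    rw [← pow_add, Nat.sub_add_cancel hjn]
  rw [div_pow, h4] at h1
  rw [h2, h3]
  have h5 : 0 < (n : ℝ) ^ j * Real.exp 1 := by positivity
  refine le_of_mul_le_mul_right ?_ h5
  calc (Real.exp 1)⁻¹ * E * (n - j).factorial * ((n : ℝ) ^ j * Real.exp 1)
      = (n - j).factorial * ((n : ℝ) ^ j * E) := by field_simp
    _ ≤ _ := h1
    _ = _ := by field_simp

lemma exp_neg_eight_le_sum_poisson_weight {T s : ℕ} (hT : 9 ≤ T) (hs : √(T : ℝ) ≤ s)
    (hs' : (s : ℝ) < √T + 1) :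
    Real.exp (-8) ≤ ∑ k ∈ Finset.Icc (T + 1 - 2 * s) (T - s),
      Real.exp (-(T : ℝ)) * T ^ k / k.factorial := by
  have hT' : (9 : ℝ) ≤ T := by exact_mod_cast hT
  have hsq : √(T : ℝ) * √T = T := Real.mul_self_sqrt (by linarith)
  have h3 : 3 ≤ √(T : ℝ) := Real.le_sqrt_of_sq_le (by linarith)
  have hsT : 6 * s ≤ 2 * T + 6 := by
    have : (6 : ℝ) * s < 2 * T + 6 := by nlinarith
    exact_mod_cast this.le
  have h3s : 3 ≤ s := by exact_mod_cast h3.trans hs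
  have hcard : (Finset.Icc (T + 1 - 2 * s) (T - s)).card = s := by
    rw [Nat.card_Icc]
    omega
  have hterm : ∀ k ∈ Finset.Icc (T + 1 - 2 * s) (T - s),
      Real.exp (-8) / √T ≤ Real.exp (-(T : ℝ)) * T ^ k / k.factorial := by
    intro k hk
    rw [Finset.mem_Icc] at hk
    obtain ⟨j, rfl, hjT, hj⟩ : ∃ j, k = T - j ∧ j ≤ T ∧ j + 1 ≤ 2 * s :=
      ⟨T - k, by omega, by omega, by omega⟩
    refine le_trans ?_ (exp_div_sqrt_le_poisson_weight (by omega) hjT (by omega))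
    have hjs : (j : ℝ) + 1 ≤ 2 * s := by exact_mod_cast hj
    have hj0 : (0 : ℝ) ≤ j := j.cast_nonneg
    have hexp : 3 * ((j : ℝ) * (j - 1)) / (2 * T) ≤ 7 := by
      rw [div_le_iff₀ (by linarith)]
      nlinarith
    gcongr
    linarith
  have := Finset.card_nsmul_le_sum _ _ _ hterm
  rw [hcard, nsmul_eq_mul] at this
  refine le_trans ?_ this
  rw [mul_div_assoc', le_div_iff₀ (by linarith), mul_comm]
  gcongr

/-- If `Z` is a Poisson random variable whose rate is a positive integer
`T`, then `P(Z ≤ T - √T) ≥ e⁻⁹`. -/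
theorem poisson_le_rate_sub_sqrt (T : ℕ) (hT : 1 ≤ T)
    (Ω : Type) [MeasurableSpace Ω] (μ : Measure Ω) [IsProbabilityMeasure μ]
    (Z : Ω → ℕ)
    (hZ : ∀ k : ℕ, μ {ω | Z ω = k}
      = ENNReal.ofReal (Real.exp (-(T : ℝ)) * (T : ℝ) ^ k / k.factorial)) :
    ENNReal.ofReal (Real.exp (-9)) ≤ μ {ω | (Z ω : ℝ) ≤ (T : ℝ) - Real.sqrt T} := by
  have hT1 : (1 : ℝ) ≤ T := by exact_mod_cast hT
  have hsq : √(T : ℝ) * √T = T := Real.mul_self_sqrt (by linarith)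
  have h1 : 1 ≤ √(T : ℝ) := Real.le_sqrt_of_sq_le (by linarith)
  have hsT : √(T : ℝ) ≤ T := by nlinarith
  rcases Nat.lt_or_ge T 9 with hlt | hge
  · have hT9 : (T : ℝ) ≤ 9 := by exact_mod_cast hlt.le
    calc ENNReal.ofReal (Real.exp (-9)) ≤ μ {ω | Z ω = 0} := by
          rw [hZ 0]
          refine ENNReal.ofReal_le_ofReal ?_
          simpa using hT9
      _ ≤ _ := measure_mono fun ω hω ↦ by
          have hω' : Z ω = 0 := hω
          simpa [hω'] using hsT
  · have hsum : ∑' k, μ {ω | Z ω = k} = 1 := by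
      have h := ProbabilityTheory.hasSum_one_poissonMeasure (T : NNReal)
      simp only [NNReal.coe_natCast] at h
      simp_rw [hZ]
      rw [← ENNReal.ofReal_tsum_of_nonneg (fun k ↦ by positivity) h.summable, h.tsum_eq,
        ENNReal.ofReal_one]
    have hs : √(T : ℝ) ≤ ⌈√(T : ℝ)⌉₊ := Nat.le_ceil _
    have hs' : (⌈√(T : ℝ)⌉₊ : ℝ) < √T + 1 := Nat.ceil_lt_add_one (Real.sqrt_nonneg _)
    have hceil : ⌈√(T : ℝ)⌉₊ ≤ T := Nat.ceil_le.2 hsT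
    set s := ⌈√(T : ℝ)⌉₊
    set F := Finset.Icc (T + 1 - 2 * s) (T - s)
    calc ENNReal.ofReal (Real.exp (-9))
        ≤ ENNReal.ofReal (∑ k ∈ F, Real.exp (-(T : ℝ)) * T ^ k / k.factorial) :=
          ENNReal.ofReal_le_ofReal <| (Real.exp_le_exp.2 (by norm_num)).trans
            (exp_neg_eight_le_sum_poisson_weight hge hs hs')
      _ = ∑ k ∈ F, μ {ω | Z ω = k} := by
          rw [ENNReal.ofReal_sum_of_nonneg fun k _ ↦ by positivity]
          simp_rw [hZ]
      _ ≤ μ {ω | Z ω ∈ F} := sum_measure_fiber_le_measure_preimage μ Z hsum F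
      _ ≤ _ := measure_mono fun ω hω ↦ by
          have hle : Z ω ≤ T - s := (Finset.mem_Icc.1 hω).2
          have hle' : (Z ω : ℝ) + s ≤ T := by exact_mod_cast (by omega : Z ω + s ≤ T)
          show (Z ω : ℝ) ≤ T - √T
          linarith
end
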